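/- arXiv:2409.07637 — 5 statements merged into one kernel-verified Lean document; each statement's English description precedes it below -/
import Mathlib

section
/- (Sklar's Theorem, existence) Let μ be a probability measure on ℝ^d with joint CDF F(z₁,…,z_d) = μ{x : xᵢ ≤ zᵢ for all i} and marginal CDFs F₁,…,F_d (where Fᵢ is the CDF of the i-th coordinate pushforward of μ). Then there exists a copula C : [0,1]^d → [0,1], i.e. the joint CDF of a probability measure on ℝ^d all of whose one-dimensional marginals are the uniform distribution on [0,1], such that F(z₁,…,z_d) = C(F₁(z₁),…,F_d(z_d)) for all (z₁,…,z_d) ∈ ℝ^d. -/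
open MeasureTheory Set

/-- Joint CDF of a measure on `ℝ^d`: `F z = μ {x | ∀ i, x i ≤ z i}`. -/
noncomputable def jointCDF {d : ℕ} (μ : Measure (Fin d → ℝ)) (z : Fin d → ℝ) : ℝ :=
  (μ {x | ∀ i, x i ≤ z i}).toReal

/-- Marginal CDF: the CDF of the pushforward of `μ` under the `i`-th coordinate projection. -/
noncomputable def marginalCDF {d : ℕ} (μ : Measure (Fin d → ℝ)) (i : Fin d) (z : ℝ) : ℝ :=
  ((μ.map (fun x => x i)) (Set.Iic z)).toReal

/-- The uniform probability distribution on `[0,1]`. -/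
noncomputable def unif01 : Measure ℝ := volume.restrict (Set.Icc 0 1)

/-- A copula is a function `C : [0,1]^d → [0,1]` that agrees on `[0,1]^d` with the joint CDF
of a probability measure on `ℝ^d` all of whose one-dimensional marginals are the uniform
distribution on `[0,1]`. -/
def IsCopula {d : ℕ} (C : (Fin d → ℝ) → ℝ) : Prop :=
  ∃ ν : Measure (Fin d → ℝ), IsProbabilityMeasure ν ∧
    (∀ i : Fin d, ν.map (fun x => x i) = unif01) ∧
    ∀ u : Fin d → ℝ, (∀ i, u i ∈ Set.Icc (0 : ℝ) 1) → C u = jointCDF ν u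

instance unif01_prob : IsProbabilityMeasure unif01 := ⟨by simp [unif01]⟩

lemma unif01_real_Iic {t : ℝ} (h0 : 0 ≤ t) (h1 : t ≤ 1) : unif01.real (Set.Iic t) = t := by
  have : Set.Iic t ∩ Set.Icc (0:ℝ) 1 = Set.Icc 0 t := by
    ext x; simp only [Set.mem_inter_iff, Set.mem_Iic, Set.mem_Icc]
    constructor
    · rintro ⟨a, b, c⟩; exact ⟨b, a⟩
    · rintro ⟨a, b⟩; exact ⟨b, a, b.trans h1⟩
  rw [unif01, measureReal_restrict_apply measurableSet_Iic, this]
  simp [h0]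

lemma unif01_ae : ∀ᵐ v ∂unif01, v ∈ Set.Icc (0:ℝ) 1 :=
  ae_restrict_mem measurableSet_Icc

/-- The distributional transform. -/
noncomputable def dtr (m : Measure ℝ) (p : ℝ × ℝ) : ℝ :=
  m.real (Set.Iio p.1) + p.2 * m.real {p.1}

lemma Iic_split (m : Measure ℝ) [IsProbabilityMeasure m] (x : ℝ) :
    m.real (Set.Iic x) = m.real (Set.Iio x) + m.real {x} := by
  rw [← Set.Iio_union_right, measureReal_union (by simp) (measurableSet_singleton x)]

lemma measurable_dtr (m : Measure ℝ) [IsProbabilityMeasure m] : Measurable (dtr m) := by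
  have h1 : Measurable (fun x : ℝ => m.real (Set.Iio x)) :=
    Monotone.measurable (fun a b h => measureReal_mono (Set.Iio_subset_Iio h))
  have h2 : Measurable (fun x : ℝ => m.real (Set.Iic x)) :=
    Monotone.measurable (fun a b h => measureReal_mono (Set.Iic_subset_Iic.2 h))
  have h3 : Measurable (fun x : ℝ => m.real {x}) := by
    have : (fun x : ℝ => m.real {x}) = fun x => m.real (Set.Iic x) - m.real (Set.Iio x) := by
      ext x; rw [Iic_split]; ring
    rw [this]; exact h2.sub h1
  exact (h1.comp measurable_fst).add (measurable_snd.mul (h3.comp measurable_fst))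

lemma exists_quantile (m : Measure ℝ) [IsProbabilityMeasure m] {u : ℝ} (h0 : 0 < u) (h1 : u < 1) :
    ∃ q, u ≤ m.real (Set.Iic q) ∧ (∀ x < q, m.real (Set.Iic x) < u) ∧ m.real (Set.Iio q) ≤ u := by
  have hF : ∀ x, m.real (Set.Iic x) = ProbabilityTheory.cdf m x :=
    fun x => (ProbabilityTheory.cdf_eq_real m x).symm
  simp only [hF]
  set F := ProbabilityTheory.cdf m with hFdef
  set S := {x | u ≤ F x} with hS
  have hne : S.Nonempty :=
    (((ProbabilityTheory.tendsto_cdf_atTop m).eventually_const_lt h1).exists).imp fun x h => h.le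
  obtain ⟨b, hb⟩ := ((ProbabilityTheory.tendsto_cdf_atBot m).eventually_lt_const h0).exists
  have hbdd : BddBelow S := ⟨b, fun x hx => by
    by_contra hlt
    push Not at hlt
    have h2 : F x ≤ F b := F.mono hlt.le
    have h3 : u ≤ F x := hx
    have h4 : F b < u := hb
    linarith⟩
  have hlt : ∀ x < sInf S, F x < u := fun x hx => by
    by_contra h
    exact absurd (csInf_le hbdd (show x ∈ S from not_lt.1 h)) (not_le.2 hx)
  refine ⟨sInf S, ?_, hlt, ?_⟩
  · have hr := (F.right_continuous (sInf S)).mono_left (nhdsWithin_mono _ Set.Ioi_subset_Ici_self)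
    refine ge_of_tendsto hr ?_
    filter_upwards [self_mem_nhdsWithin] with y hy
    obtain ⟨s, hs, hsy⟩ := exists_lt_of_csInf_lt hne hy
    exact le_trans hs (F.mono hsy.le)
  · have hl : Function.leftLim F (sInf S) ≤ u := by
      refine le_of_tendsto (F.mono.tendsto_leftLim (sInf S)) ?_
      filter_upwards [self_mem_nhdsWithin] with y hy
      exact (hlt y hy).le
    have : m (Set.Iio (sInf S)) = ENNReal.ofReal (Function.leftLim F (sInf S) - 0) := by
      rw [← F.measure_Iio (ProbabilityTheory.tendsto_cdf_atBot m), hFdef,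
        ProbabilityTheory.measure_cdf]
    rw [measureReal_def, this, sub_zero]
    exact ENNReal.toReal_le_of_le_ofReal h0.le (ENNReal.ofReal_le_ofReal hl)

lemma dtr_lower (m : Measure ℝ) [IsProbabilityMeasure m] {u : ℝ} (h0 : 0 < u) (h1 : u < 1) :
    u ≤ (m.prod unif01).real {p | dtr m p ≤ u} := by
  obtain ⟨q, hq1, hq2, hq3⟩ := exists_quantile m h0 h1
  have hs := Iic_split m q
  set D := m.real {q} with hD
  set c := u - m.real (Set.Iio q) with hc
  have hD0 : 0 ≤ D := measureReal_nonneg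
  have key : c ≤ D * unif01.real {v | v * D ≤ c} := by
    rcases hD0.eq_or_lt with h | h
    · rw [← h]; linarith
    · have hsub : Set.Iic (c / D) ⊆ {v | v * D ≤ c} := fun v hv => (le_div_iff₀ h).1 hv
      have := measureReal_mono (μ := unif01) hsub
      rw [unif01_real_Iic (by apply div_nonneg <;> linarith)
        ((div_le_one h).2 (by linarith))] at this
      calc c = D * (c / D) := by field_simp
        _ ≤ _ := by gcongr
  have hle : (m.prod unif01).real (Set.Iio q ×ˢ Set.univ ∪ {q} ×ˢ {v | v * D ≤ c}) ≤
      (m.prod unif01).real {p | dtr m p ≤ u} := by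
    refine ENNReal.toReal_mono (measure_ne_top _ _) (measure_mono_ae ?_)
    have hae : ∀ᵐ p ∂(m.prod unif01), p.2 ∈ Set.Icc (0:ℝ) 1 :=
      Measure.quasiMeasurePreserving_snd.ae unif01_ae
    filter_upwards [hae] with p hp hmem
    show dtr m p ≤ u
    obtain ⟨x, v⟩ := p
    rcases hmem with h | h
    · have h2 := hq2 x h.1
      rw [Iic_split] at h2
      have : v * m.real {x} ≤ m.real {x} := mul_le_of_le_one_left measureReal_nonneg hp.2
      simp only [dtr]; linarith
    · obtain ⟨rfl, h⟩ : x = q ∧ v * D ≤ c := h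
      simp only [dtr]; linarith
  rw [measureReal_union (by
      rw [Set.disjoint_left]; rintro ⟨x, v⟩ h h'
      exact absurd h.1 (by rw [show x = q from h'.1]; simp))
    ((measurableSet_singleton q).prod (measurableSet_le (by fun_prop) (by fun_prop))),
    measureReal_prod_prod, measureReal_prod_prod] at hle
  simp only [probReal_univ, mul_one] at hle
  linarith

lemma dtr_upper (m : Measure ℝ) [IsProbabilityMeasure m] {u : ℝ} (h0 : 0 < u) (h1 : u < 1) :
    (m.prod unif01).real {p | dtr m p < u} ≤ u := by
  obtain ⟨q, hq1, hq2, hq3⟩ := exists_quantile m h0 h1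
  have hs := Iic_split m q
  set D := m.real {q} with hD
  set c := u - m.real (Set.Iio q) with hc
  have hD0 : 0 ≤ D := measureReal_nonneg
  have key : D * unif01.real {v | v * D < c} ≤ c := by
    rcases hD0.eq_or_lt with h | h
    · rw [← h]; linarith
    · have hsub : {v | v * D < c} ⊆ Set.Iic (c / D) :=
        fun v hv => (le_div_iff₀ h).2 (le_of_lt hv)
      have := measureReal_mono (μ := unif01) hsub
      rw [unif01_real_Iic (by apply div_nonneg <;> linarith)
        ((div_le_one h).2 (by linarith))] at this
      calc _ ≤ D * (c / D) := by gcongr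
        _ = c := by field_simp
  have hle : (m.prod unif01).real {p | dtr m p < u} ≤
      (m.prod unif01).real (Set.Iio q ×ˢ Set.univ ∪ {q} ×ˢ {v | v * D < c}) := by
    refine ENNReal.toReal_mono (measure_ne_top _ _) (measure_mono_ae ?_)
    have hae : ∀ᵐ p ∂(m.prod unif01), p.2 ∈ Set.Icc (0:ℝ) 1 :=
      Measure.quasiMeasurePreserving_snd.ae unif01_ae
    filter_upwards [hae] with p hp hmem
    obtain ⟨x, v⟩ := p
    have hmem : m.real (Set.Iio x) + v * m.real {x} < u := hmem
    rcases lt_trichotomy x q with h | h | h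
    · exact Or.inl ⟨h, trivial⟩
    · refine Or.inr ⟨h, ?_⟩
      subst h
      show v * D < c
      linarith
    · exfalso
      have h2 : m.real (Set.Iic q) ≤ m.real (Set.Iio x) :=
        measureReal_mono (Set.Iic_subset_Iio.2 h)
      have : 0 ≤ v * m.real {x} := mul_nonneg hp.1 measureReal_nonneg
      linarith
  have h3 := hle.trans (measureReal_union_le _ _)
  rw [measureReal_prod_prod, measureReal_prod_prod] at h3
  simp only [probReal_univ, mul_one] at h3
  linarith

lemma map_dtr (m : Measure ℝ) [IsProbabilityMeasure m] :
    (m.prod unif01).map (dtr m) = unif01 := by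
  have hm := measurable_dtr m
  haveI : IsProbabilityMeasure ((m.prod unif01).map (dtr m)) :=
    Measure.isProbabilityMeasure_map hm.aemeasurable
  -- both sides are determined by these two bounds
  have gen : ∀ ρ : Measure ℝ, IsProbabilityMeasure ρ →
      (∀ u, 0 < u → u < 1 → u ≤ ρ.real (Set.Iic u)) →
      (∀ u, 0 < u → u < 1 → ρ.real (Set.Iio u) ≤ u) →
      ∀ a, ρ.real (Set.Iic a) = max 0 (min a 1) := by
    intro ρ _ hl hu a
    apply le_antisymm
    · refine le_of_forall_gt_imp_ge_of_dense fun u hu' => ?_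
      rw [max_lt_iff, min_lt_iff] at hu'
      by_cases h1 : u < 1
      · refine le_trans (measureReal_mono (Set.Iic_subset_Iio.2 ?_)) (hu u hu'.1 h1)
        rcases hu'.2 with h | h <;> linarith
      · exact measureReal_le_one.trans (not_lt.1 h1)
    · refine le_of_forall_lt_imp_le_of_dense fun u hu' => ?_
      rcases le_or_gt u 0 with h | h
      · exact h.trans measureReal_nonneg
      · rw [lt_max_iff, lt_min_iff] at hu'
        rcases hu' with h2 | h2
        · linarith
        · exact (hl u h h2.2).trans (measureReal_mono (Set.Iic_subset_Iic.2 h2.1.le))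
  refine Measure.ext_of_Iic _ _ fun a => ?_
  rw [← measureReal_eq_measureReal_iff, gen _ inferInstance ?_ ?_ a, gen unif01 inferInstance ?_ ?_ a]
  · intro u h0 h1; rw [unif01_real_Iic h0.le h1.le]
  · intro u h0 h1
    exact (measureReal_mono Set.Iio_subset_Iic_self).trans (unif01_real_Iic h0.le h1.le).le
  · intro u h0 h1
    rw [map_measureReal_apply hm measurableSet_Iic]
    exact dtr_lower m h0 h1
  · intro u h0 h1
    rw [map_measureReal_apply hm measurableSet_Iio]
    exact dtr_upper m h0 h1

/-- **Sklar's theorem, existence**: every probability measure `μ` on `ℝ^d` admits a copula `C`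
such that `F(z₁,…,z_d) = C(F₁(z₁),…,F_d(z_d))` for all `z`, where `F` is the joint CDF of `μ`
and `F₁,…,F_d` are its marginal CDFs. -/
theorem sklar_existence {d : ℕ} (μ : Measure (Fin d → ℝ)) [IsProbabilityMeasure μ] :
    ∃ C : (Fin d → ℝ) → ℝ, IsCopula C ∧
      ∀ z : Fin d → ℝ, jointCDF μ z = C (fun i => marginalCDF μ i (z i)) := by
  have hmp : ∀ i, IsProbabilityMeasure (μ.map (fun x : Fin d → ℝ => x i)) := fun i =>
    Measure.isProbabilityMeasure_map (measurable_pi_apply i).aemeasurable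
  set P := μ.prod unif01 with hP
  let U : (Fin d → ℝ) × ℝ → Fin d → ℝ := fun p i => dtr (μ.map (fun x => x i)) (p.1 i, p.2)
  have hUi : ∀ i, Measurable (fun p => U p i) := fun i =>
    (measurable_dtr (μ.map (fun x : Fin d → ℝ => x i))).comp
      (((measurable_pi_apply i).comp measurable_fst).prodMk measurable_snd)
  have hU : Measurable U := measurable_pi_iff.2 hUi
  have hmap : ∀ i, P.map (fun p => U p i) = unif01 := fun i => by
    have h := map_dtr (μ.map (fun x : Fin d → ℝ => x i))
    have h2 := Measure.map_prod_map μ unif01 (measurable_pi_apply (X := fun _ : Fin d => ℝ) i)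
      measurable_id
    rw [Measure.map_id] at h2
    have h3 : (μ.map (fun x : Fin d → ℝ => x i)).prod unif01 = P.map (Prod.map (fun x => x i) id) :=
      h2
    rw [h3, Measure.map_map (measurable_dtr _) ((measurable_pi_apply i).prodMap measurable_id)] at h
    exact h
  refine ⟨jointCDF (P.map U), ⟨P.map U, Measure.isProbabilityMeasure_map hU.aemeasurable, ?_,
    fun u _ => rfl⟩, fun z => ?_⟩
  · intro i
    rw [Measure.map_map (measurable_pi_apply i) hU]
    exact hmap i
  have hae2 : ∀ᵐ p ∂P, p.2 ∈ Set.Icc (0:ℝ) 1 :=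
    Measure.quasiMeasurePreserving_snd.ae unif01_ae
  have hi : ∀ i, ({p : (Fin d → ℝ) × ℝ | p.1 i ≤ z i} : Set _) =ᵐ[P]
      {p | U p i ≤ marginalCDF μ i (z i)} := by
    intro i
    have hA : MeasurableSet {p : (Fin d → ℝ) × ℝ | p.1 i ≤ z i} :=
      measurableSet_le ((measurable_pi_apply i).comp measurable_fst) measurable_const
    refine ae_eq_of_ae_subset_of_measure_ge ?_ ?_ hA.nullMeasurableSet (measure_ne_top _ _)
    · filter_upwards [hae2] with p hp hmem
      have hmem : p.1 i ≤ z i := hmem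
      show (μ.map (fun x : Fin d → ℝ => x i)).real _ + p.2 * (μ.map (fun x : Fin d → ℝ => x i)).real _
        ≤ (μ.map (fun x : Fin d → ℝ => x i)).real _
      have h1 := Iic_split (μ.map (fun x : Fin d → ℝ => x i)) (p.1 i)
      have h2 : (μ.map (fun x : Fin d → ℝ => x i)).real (Set.Iic (p.1 i)) ≤
        (μ.map (fun x : Fin d → ℝ => x i)).real (Set.Iic (z i)) :=
        measureReal_mono (Set.Iic_subset_Iic.2 hmem)
      have h3 : p.2 * (μ.map (fun x : Fin d → ℝ => x i)).real {p.1 i} ≤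
          (μ.map (fun x : Fin d → ℝ => x i)).real {p.1 i} :=
        mul_le_of_le_one_left measureReal_nonneg hp.2
      dsimp only
      linarith
    · apply le_of_eq
      rw [← measureReal_eq_measureReal_iff]
      have e1 : P.real {p | U p i ≤ marginalCDF μ i (z i)} = marginalCDF μ i (z i) := by
        have := unif01_real_Iic (t := marginalCDF μ i (z i)) ENNReal.toReal_nonneg
          (measureReal_le_one (μ := μ.map (fun x : Fin d → ℝ => x i)))
        rw [← hmap i, map_measureReal_apply (hUi i) measurableSet_Iic] at this
        exact this
      have e2 : {p : (Fin d → ℝ) × ℝ | p.1 i ≤ z i} = {x : Fin d → ℝ | x i ≤ z i} ×ˢ Set.univ := by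
        ext; simp
      rw [e1, e2, hP, measureReal_prod_prod, probReal_univ, mul_one]
      exact map_measureReal_apply (measurable_pi_apply i) measurableSet_Iic
  have hall : ∀ᵐ p ∂P, ∀ i, (p.1 i ≤ z i ↔ U p i ≤ marginalCDF μ i (z i)) :=
    ae_all_iff.2 fun i => (hi i).mem_iff
  have hbox : ∀ w : Fin d → ℝ, MeasurableSet {x : Fin d → ℝ | ∀ i, x i ≤ w i} := fun w =>
    measurableSet_Iic (a := w)
  unfold jointCDF
  rw [Measure.map_apply hU (hbox _)]
  have e3 : μ {x | ∀ i, x i ≤ z i} = P ({x | ∀ i, x i ≤ z i} ×ˢ Set.univ) := by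
    rw [hP, Measure.prod_prod, measure_univ, mul_one]
  rw [e3]
  congr 1
  refine measure_congr ?_
  filter_upwards [hall] with p hp
  apply propext
  show (p ∈ _ ×ˢ _) ↔ ∀ i, U p i ≤ _
  simp [hp]
end

section
/- (Sklar's Theorem, uniqueness) Let μ be a probability measure on ℝ^d with joint CDF F and marginal CDFs F₁,…,F_d. If every marginal CDF Fᵢ is continuous, then the copula C satisfying F(z₁,…,z_d) = C(F₁(z₁),…,F_d(z_d)) for all z ∈ ℝ^d is unique: any two copulas C and C' satisfying this identity agree on all of [0,1]^d. -/
open MeasureTheory Set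

lemma marginal_mem_closure {d : ℕ} (μ : Measure (Fin d → ℝ)) [IsProbabilityMeasure μ] (i : Fin d)
    (hc : Continuous (marginalCDF μ i)) (t : ℝ) (ht : t ∈ Set.Icc (0 : ℝ) 1) :
    t ∈ closure (Set.range (marginalCDF μ i)) := by
  haveI : IsProbabilityMeasure (μ.map (fun x => x i)) :=
    Measure.isProbabilityMeasure_map (measurable_pi_apply i).aemeasurable
  have he : marginalCDF μ i = ProbabilityTheory.cdf (μ.map (fun x => x i)) := by
    funext z
    rw [ProbabilityTheory.cdf_eq_real]
    rfl
  have h0 := ProbabilityTheory.tendsto_cdf_atBot (μ.map (fun x => x i))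
  have h1 := ProbabilityTheory.tendsto_cdf_atTop (μ.map (fun x => x i))
  rw [← he] at h0 h1
  rw [← closure_Ioo (zero_ne_one' ℝ)] at ht
  refine closure_mono ?_ ht
  intro s hs
  exact mem_range_of_exists_le_of_exists_ge hc
    ((h0.eventually (gt_mem_nhds hs.1)).exists.imp fun _ h => h.le)
    ((h1.eventually (lt_mem_nhds hs.2)).exists.imp fun _ h => h.le)

lemma jointCDF_le {d : ℕ} (ν : Measure (Fin d → ℝ)) [IsProbabilityMeasure ν]
    (hν : ∀ i : Fin d, ν.map (fun x => x i) = unif01) (u v : Fin d → ℝ) :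
    jointCDF ν u ≤ jointCDF ν v + ∑ i, |u i - v i| := by
  have hsub : {x : Fin d → ℝ | ∀ i, x i ≤ u i} ⊆
      {x | ∀ i, x i ≤ v i} ∪ ⋃ i, (fun x : Fin d → ℝ => x i) ⁻¹' (Set.Ioc (v i) (u i)) := by
    intro x hx
    by_cases h : ∀ i, x i ≤ v i
    · exact Or.inl h
    · push Not at h
      obtain ⟨i, hi⟩ := h
      exact Or.inr (Set.mem_iUnion.2 ⟨i, hi, hx i⟩)
  have hi : ∀ i, ν.real ((fun x : Fin d → ℝ => x i) ⁻¹' (Set.Ioc (v i) (u i))) ≤ |u i - v i| := by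
    intro i
    have h : ν ((fun x : Fin d → ℝ => x i) ⁻¹' (Set.Ioc (v i) (u i)))
        ≤ ENNReal.ofReal (u i - v i) := by
      rw [← Measure.map_apply (measurable_pi_apply i) measurableSet_Ioc, hν i, unif01,
        ← Real.volume_Ioc]
      exact Measure.restrict_apply_le _ _
    exact ENNReal.toReal_le_of_le_ofReal (abs_nonneg _)
      (h.trans (ENNReal.ofReal_le_ofReal (le_abs_self _)))
  calc jointCDF ν u = ν.real {x : Fin d → ℝ | ∀ i, x i ≤ u i} := rfl
    _ ≤ _ := measureReal_mono hsub
    _ ≤ _ := measureReal_union_le _ _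
    _ ≤ jointCDF ν v + ∑ i, |u i - v i| :=
      add_le_add le_rfl ((measureReal_iUnion_fintype_le _).trans
        (Finset.sum_le_sum fun i _ => hi i))

lemma sklar_le {d : ℕ} (μ : Measure (Fin d → ℝ)) [IsProbabilityMeasure μ]
    (hcont : ∀ i : Fin d, Continuous (marginalCDF μ i))
    (C C' : (Fin d → ℝ) → ℝ) (hC : IsCopula C) (hC' : IsCopula C')
    (hSklar : ∀ z : Fin d → ℝ, jointCDF μ z = C (fun i => marginalCDF μ i (z i)))
    (hSklar' : ∀ z : Fin d → ℝ, jointCDF μ z = C' (fun i => marginalCDF μ i (z i)))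
    (u : Fin d → ℝ) (hu : ∀ i, u i ∈ Set.Icc (0 : ℝ) 1) : C u ≤ C' u := by
  obtain ⟨ν, _, hν, hCν⟩ := hC
  obtain ⟨ν', _, hν', hCν'⟩ := hC'
  have key : ∀ ε > 0, C u ≤ C' u + 2 * d * ε := by
    intro ε hε
    have hex : ∀ i, ∃ z, |u i - marginalCDF μ i z| < ε := by
      intro i
      obtain ⟨_, ⟨z, rfl⟩, hz⟩ :=
        Metric.mem_closure_iff.1 (marginal_mem_closure μ i (hcont i) (u i) (hu i)) ε hε
      exact ⟨z, hz⟩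
    choose z hz using hex
    have hv : ∀ i, marginalCDF μ i (z i) ∈ Set.Icc (0 : ℝ) 1 := by
      intro i
      haveI : IsProbabilityMeasure (μ.map (fun x => x i)) :=
        Measure.isProbabilityMeasure_map (measurable_pi_apply i).aemeasurable
      exact ⟨ENNReal.toReal_nonneg, measureReal_le_one⟩
    have hs : ∑ i, |u i - marginalCDF μ i (z i)| ≤ d * ε := by
      refine (Finset.sum_le_sum fun i _ => (hz i).le).trans ?_
      simp
    have hs' : ∑ i, |marginalCDF μ i (z i) - u i| ≤ d * ε := by
      simpa only [abs_sub_comm] using hs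
    have e := (hSklar z).symm.trans (hSklar' z)
    rw [hCν _ hv, hCν' _ hv] at e
    have a := jointCDF_le ν hν u (fun i => marginalCDF μ i (z i))
    have b := jointCDF_le ν' hν' (fun i => marginalCDF μ i (z i)) u
    rw [hCν u hu, hCν' u hu]
    linarith
  refine le_of_forall_pos_le_add fun δ hδ => ?_
  have h := key (δ / (2 * d + 1)) (by positivity)
  have h2 : 2 * (d : ℝ) * (δ / (2 * d + 1)) ≤ δ := by
    rw [← mul_div_assoc, div_le_iff₀ (by positivity)]
    nlinarith
  linarith

/-- **Sklar's theorem, uniqueness**: if all the marginal CDFs of `μ` are continuous, then any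
two copulas `C`, `C'` satisfying `F(z) = C(F₁(z₁),…,F_d(z_d))` for all `z` agree on all of
`[0,1]^d`. -/
theorem sklar_uniqueness {d : ℕ} (μ : Measure (Fin d → ℝ)) [IsProbabilityMeasure μ]
    (hcont : ∀ i : Fin d, Continuous (marginalCDF μ i))
    (C C' : (Fin d → ℝ) → ℝ) (hC : IsCopula C) (hC' : IsCopula C')
    (hSklar : ∀ z : Fin d → ℝ, jointCDF μ z = C (fun i => marginalCDF μ i (z i)))
    (hSklar' : ∀ z : Fin d → ℝ, jointCDF μ z = C' (fun i => marginalCDF μ i (z i))) :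
    ∀ u : Fin d → ℝ, (∀ i, u i ∈ Set.Icc (0 : ℝ) 1) → C u = C' u := by
  intro u hu
  exact le_antisymm (sklar_le μ hcont C C' hC hC' hSklar hSklar' u hu)
    (sklar_le μ hcont C' C hC' hC hSklar' hSklar u hu)
end

section
/- (Explicit formula for the copula) Let μ be a probability measure on ℝ^d with joint CDF F and marginal CDFs F₁,…,F_d, all of which are continuous. Then the unique copula C of μ is given explicitly by C(u₁,…,u_d) = F(F₁⁻¹(u₁),…,F_d⁻¹(u_d)) for all u ∈ (0,1)^d, where Fᵢ⁻¹(u) = inf{z : Fᵢ(z) ≥ u}; equivalently, C is the joint CDF of the random vector (F₁(Z₁),…,F_d(Z_d)) where (Z₁,…,Z_d) has law μ. -/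
open MeasureTheory Set

open ProbabilityTheory Filter Topology

lemma cdf_level_null (m : Measure ℝ) [IsProbabilityMeasure m] (hc : Continuous (cdf m)) (t : ℝ) :
    m {x | cdf m x = t} = 0 := by
  have hcl : IsClosed {x | cdf m x = t} := isClosed_eq hc continuous_const
  have hU : {x | cdf m x = t} ⊆ ⋃ n : ℕ, {x | cdf m x = t} ∩ Icc (-(n : ℝ)) n := by
    intro x hx
    obtain ⟨n, hn⟩ := exists_nat_ge |x|
    exact mem_iUnion.2 ⟨n, hx, abs_le.1 hn⟩
  refine measure_mono_null hU (measure_iUnion_null fun n => ?_)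
  rcases ({x | cdf m x = t} ∩ Icc (-(n : ℝ)) n).eq_empty_or_nonempty with h | h
  · simp [h]
  have hK : IsCompact ({x | cdf m x = t} ∩ Icc (-(n : ℝ)) n) := isCompact_Icc.inter_left hcl
  obtain ⟨a, ha, ha'⟩ := hK.exists_isLeast h
  obtain ⟨b, hb, hb'⟩ := hK.exists_isGreatest h
  refine measure_mono_null (t := Icc a b) (fun x hx => ⟨ha' hx, hb' hx⟩) ?_
  rw [← measure_cdf m, StieltjesFunction.measure_Icc, hc.continuousAt.continuousWithinAt.leftLim_eq]
  have h1 : cdf m a = t := ha.1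
  have h2 : cdf m b = t := hb.1
  simp [h1, h2]

lemma cdf_quantile (m : Measure ℝ) [IsProbabilityMeasure m] (hc : Continuous (cdf m)) (u : ℝ)
    (hu : u ∈ Ioo (0 : ℝ) 1) : cdf m (sInf {z | u ≤ cdf m z}) = u := by
  obtain ⟨a, ha⟩ := ((tendsto_cdf_atBot m).eventually (gt_mem_nhds hu.1)).exists
  obtain ⟨b, hb⟩ := ((tendsto_cdf_atTop m).eventually (lt_mem_nhds hu.2)).exists
  obtain ⟨w, hw⟩ := mem_range_of_exists_le_of_exists_ge hc ⟨a, ha.le⟩ ⟨b, hb.le⟩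
  have hbdd : BddBelow {z | u ≤ cdf m z} := by
    refine ⟨a, fun z hz => ?_⟩
    by_contra h
    have h1 := monotone_cdf m (not_le.1 h).le
    have h2 : u ≤ cdf m z := hz
    linarith
  have hcl : IsClosed {z | u ≤ cdf m z} := isClosed_le continuous_const hc
  refine le_antisymm ?_ (hcl.csInf_mem ⟨w, hw.ge⟩ hbdd)
  exact (monotone_cdf m (csInf_le hbdd hw.ge)).trans hw.le

lemma continuous_jointCDF {d : ℕ} (ν : Measure (Fin d → ℝ)) [IsProbabilityMeasure ν]
    (h : ∀ i t, ν {x | x i = t} = 0) : Continuous (jointCDF ν) := by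
  rw [continuous_iff_continuousAt]
  intro u
  unfold ContinuousAt jointCDF
  refine (ENNReal.tendsto_toReal (measure_ne_top _ _)).comp ?_
  have hm : ∀ v : Fin d → ℝ, MeasurableSet {x : Fin d → ℝ | ∀ i, x i ≤ v i} := fun v =>
    measurableSet_Iic (a := v)
  refine tendsto_measure_of_ae_tendsto_indicator_of_isFiniteMeasure (𝓝 u) (hm u) hm ?_
  have hae : ∀ᵐ x ∂ν, ∀ i, x i ≠ u i := by
    rw [ae_all_iff]
    intro i
    rw [ae_iff]
    simpa using h i (u i)
  filter_upwards [hae] with x hx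
  have : ∀ᶠ v in 𝓝 u, ∀ i, (x i ≤ v i ↔ x i ≤ u i) := by
    rw [eventually_all]
    intro i
    have hi : Tendsto (fun v : Fin d → ℝ => v i) (𝓝 u) (𝓝 (u i)) := (continuous_apply i).tendsto u
    rcases lt_or_gt_of_ne (hx i) with h1 | h1
    · filter_upwards [hi.eventually (lt_mem_nhds h1)] with v hv
      exact ⟨fun _ => h1.le, fun _ => hv.le⟩
    · filter_upwards [hi.eventually (gt_mem_nhds h1)] with v hv
      exact ⟨fun h => absurd h (not_le.2 hv), fun h => absurd h (not_le.2 h1)⟩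
  filter_upwards [this] with v hv
  exact forall_congr' hv

/-- **Explicit formula for the copula**: if all marginal CDFs of `μ` are continuous, then the
(unique) copula `C` of `μ` satisfies `C(u) = F(F₁⁻¹(u₁),…,F_d⁻¹(u_d))` on `(0,1)^d`, where
`Fᵢ⁻¹(u) = inf {z | Fᵢ z ≥ u}`; equivalently, `C` agrees on `[0,1]^d` with the joint CDF of
the random vector `(F₁(Z₁),…,F_d(Z_d))` where `Z ∼ μ`. -/
theorem copula_explicit_formula {d : ℕ} (μ : Measure (Fin d → ℝ)) [IsProbabilityMeasure μ]
    (hcont : ∀ i : Fin d, Continuous (marginalCDF μ i))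
    (C : (Fin d → ℝ) → ℝ) (hC : IsCopula C)
    (hSklar : ∀ z : Fin d → ℝ, jointCDF μ z = C (fun i => marginalCDF μ i (z i))) :
    (∀ u : Fin d → ℝ, (∀ i, u i ∈ Set.Ioo (0 : ℝ) 1) →
        C u = jointCDF μ (fun i => sInf {z : ℝ | u i ≤ marginalCDF μ i z})) ∧
    (∀ u : Fin d → ℝ, (∀ i, u i ∈ Set.Icc (0 : ℝ) 1) →
        C u = jointCDF (μ.map (fun x i => marginalCDF μ i (x i))) u) := by
  have hp : ∀ i : Fin d, IsProbabilityMeasure (μ.map (fun x => x i)) := fun i =>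
    Measure.isProbabilityMeasure_map (measurable_pi_apply i).aemeasurable
  have hF : ∀ i, marginalCDF μ i = cdf (μ.map (fun x => x i)) := by
    intro i
    ext z
    rw [cdf_eq_real]
    rfl
  have hc : ∀ i, Continuous (cdf (μ.map (fun x => x i))) := fun i => hF i ▸ hcont i
  have hq : ∀ u : Fin d → ℝ, (∀ i, u i ∈ Set.Ioo (0 : ℝ) 1) → ∀ i,
      marginalCDF μ i (sInf {z : ℝ | u i ≤ marginalCDF μ i z}) = u i := by
    intro u hu i
    rw [hF]
    exact cdf_quantile _ (hc i) _ (hu i)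
  have hmono : ∀ i, Monotone (marginalCDF μ i) := fun i => by
    rw [hF]
    exact monotone_cdf _
  have hlev : ∀ i t, μ {x | marginalCDF μ i (x i) = t} = 0 := by
    intro i t
    have h := cdf_level_null _ (hc i) t
    rw [← hF, Measure.map_apply (measurable_pi_apply i)
      (isClosed_eq (hcont i) continuous_const).measurableSet] at h
    exact h
  have h1 : ∀ u : Fin d → ℝ, (∀ i, u i ∈ Set.Ioo (0 : ℝ) 1) →
      C u = jointCDF μ (fun i => sInf {z : ℝ | u i ≤ marginalCDF μ i z}) := by
    intro u hu
    rw [hSklar]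
    congr 1
    ext i
    exact (hq u hu i).symm
  refine ⟨h1, ?_⟩
  obtain ⟨ν, hν, hmarg, hCν⟩ := hC
  have hT : Measurable (fun (x : Fin d → ℝ) i => marginalCDF μ i (x i)) :=
    (continuous_pi fun i => (hcont i).comp (continuous_apply i)).measurable
  have hρ : IsProbabilityMeasure (μ.map (fun x i => marginalCDF μ i (x i))) :=
    Measure.isProbabilityMeasure_map hT.aemeasurable
  have hlevset : ∀ (i : Fin d) (t : ℝ), MeasurableSet {x : Fin d → ℝ | x i = t} := fun i t =>
    (isClosed_eq (continuous_apply i) continuous_const).measurableSet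
  have c1 : Continuous (jointCDF ν) := by
    refine continuous_jointCDF ν fun i t => ?_
    have h : ν.map (fun x => x i) {t} = 0 := by
      rw [hmarg i, unif01]
      exact measure_singleton t
    rwa [Measure.map_apply (measurable_pi_apply i) (measurableSet_singleton t)] at h
  have c2 : Continuous (jointCDF (μ.map (fun x i => marginalCDF μ i (x i)))) := by
    refine continuous_jointCDF _ fun i t => ?_
    rw [Measure.map_apply hT (hlevset i t)]
    exact hlev i t
  have heq : EqOn (jointCDF ν) (jointCDF (μ.map (fun x i => marginalCDF μ i (x i))))
      (Set.pi univ fun _ : Fin d => Ioo (0 : ℝ) 1) := by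
    intro u hu
    have hu' : ∀ i, u i ∈ Ioo (0 : ℝ) 1 := fun i => hu i (mem_univ i)
    rw [← hCν u fun i => Ioo_subset_Icc_self (hu' i), h1 u hu']
    unfold jointCDF
    have hmu : MeasurableSet {x : Fin d → ℝ | ∀ i, x i ≤ u i} := measurableSet_Iic (a := u)
    rw [Measure.map_apply hT hmu]
    congr 1
    apply measure_congr
    have hae : ∀ᵐ x ∂μ, ∀ i, marginalCDF μ i (x i) ≠ u i := by
      rw [ae_all_iff]
      intro i
      rw [ae_iff]
      simpa using hlev i (u i)
    filter_upwards [hae] with x hx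
    refine propext (forall_congr' fun i => ⟨fun h => ?_, fun h => ?_⟩)
    · exact (hmono i h).trans (hq u hu' i).le
    · by_contra h'
      have h2 := hmono i (not_le.1 h').le
      rw [hq u hu' i] at h2
      exact hx i (le_antisymm h h2)
  intro u hu
  rw [hCν u hu]
  refine heq.closure c1 c2 ?_
  rw [closure_pi_set]
  intro i _
  rw [closure_Ioo zero_ne_one]
  exact hu i
end

section
/- (Energy distance is nonnegative and characterizes equality of distributions) Let μ and ν be probability measures on ℝ^D with finite first moments (∫‖x‖ dμ < ∞ and ∫‖y‖ dν < ∞). Define ED(μ,ν) = 2·E‖X − Y‖ − E‖X − X'‖ − E‖Y − Y'‖, where X, X' ~ μ and Y, Y' ~ ν are all independent and ‖·‖ is the Euclidean norm. Then ED(μ,ν) ≥ 0, and ED(μ,ν) = 0 if and only if μ = ν. -/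
open MeasureTheory Set

/-- The energy distance between two probability measures `μ`, `ν` on `ℝ^D`:
`ED(μ,ν) = 2·E‖X − Y‖ − E‖X − X'‖ − E‖Y − Y'‖`, where `X, X' ∼ μ`, `Y, Y' ∼ ν` are all
independent and `‖·‖` is the Euclidean norm. -/
noncomputable def energyDist {D : ℕ} (μ ν : Measure (EuclideanSpace ℝ (Fin D))) : ℝ :=
  2 * ∫ p, ‖p.1 - p.2‖ ∂(μ.prod ν) - ∫ p, ‖p.1 - p.2‖ ∂(μ.prod μ)
    - ∫ p, ‖p.1 - p.2‖ ∂(ν.prod ν)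

lemma ed_base_integrable :
    IntegrableOn (fun u : ℝ => (1 - Real.exp (-u ^ 2)) / u ^ 2) (Ioi 0) := by
  have h : Integrable (fun u : ℝ => 2 * (1 + u ^ 2)⁻¹) (volume.restrict (Ioi 0)) :=
    (integrable_inv_one_add_sq.const_mul 2).integrableOn
  refine h.mono' (by
    apply Measurable.aestronglyMeasurable
    fun_prop) ?_
  filter_upwards [ae_restrict_mem measurableSet_Ioi] with u hu
  have hu : 0 < u := hu
  have h1 : 0 < u ^ 2 := by positivity
  have h2 := Real.add_one_le_exp (-u ^ 2)
  have h3 := Real.exp_pos (-u ^ 2)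
  have h4 : Real.exp (-u ^ 2) ≤ 1 := Real.exp_le_one_iff.mpr (by linarith)
  rw [Real.norm_eq_abs, abs_of_nonneg (div_nonneg (by linarith) h1.le), ← div_eq_mul_inv,
    div_le_div_iff₀ h1 (by linarith)]
  rcases le_total (u ^ 2) 1 with h | h <;> nlinarith

lemma ed_scaled (r : ℝ) (hr : 0 ≤ r) :
    IntegrableOn (fun s : ℝ => (1 - Real.exp (-(s ^ 2 * r ^ 2))) / s ^ 2) (Ioi 0) ∧
    ∫ s in Ioi (0:ℝ), (1 - Real.exp (-(s ^ 2 * r ^ 2))) / s ^ 2 =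
      r * ∫ u in Ioi (0:ℝ), (1 - Real.exp (-u ^ 2)) / u ^ 2 := by
  rcases hr.eq_or_lt with rfl | hr
  · simp
  have e : (fun s : ℝ => (1 - Real.exp (-(s ^ 2 * r ^ 2))) / s ^ 2) =
      fun s => r ^ 2 * ((fun u : ℝ => (1 - Real.exp (-u ^ 2)) / u ^ 2) (r * s)) := by
    ext s
    have : (r * s) ^ 2 = s ^ 2 * r ^ 2 := by ring
    simp only [this]
    rcases eq_or_ne s 0 with rfl | hs
    · simp
    · field_simp
  rw [e]
  constructor
  · apply Integrable.const_mul
    have := (integrableOn_Ioi_comp_mul_left_iff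
      (fun u : ℝ => (1 - Real.exp (-u ^ 2)) / u ^ 2) 0 hr).2 (by
        simpa using ed_base_integrable)
    exact this
  · rw [integral_const_mul, integral_comp_mul_left_Ioi
      (fun u : ℝ => (1 - Real.exp (-u ^ 2)) / u ^ 2) _ hr]
    simp only [mul_zero, smul_eq_mul]
    field_simp

lemma ed_const_pos : 0 < ∫ u in Ioi (0:ℝ), (1 - Real.exp (-u ^ 2)) / u ^ 2 := by
  have hp : ∀ u : ℝ, 0 < u → 0 < (1 - Real.exp (-u ^ 2)) / u ^ 2 := by
    intro u hu
    have h1 : 0 < u ^ 2 := by positivity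
    have : Real.exp (-u ^ 2) < 1 := by
      rw [← Real.exp_zero]
      exact Real.exp_lt_exp.mpr (by linarith)
    exact div_pos (by linarith) h1
  rw [setIntegral_pos_iff_support_of_nonneg_ae _ ed_base_integrable]
  · have : Ioi (0:ℝ) ⊆ Function.support (fun u : ℝ => (1 - Real.exp (-u ^ 2)) / u ^ 2) ∩ Ioi 0 :=
      fun u hu => ⟨(hp u hu).ne', hu⟩
    refine lt_of_lt_of_le ?_ (measure_mono this)
    simp
  · filter_upwards [ae_restrict_mem measurableSet_Ioi] with u hu
    exact (hp u hu).le

section EDAux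

variable {D : ℕ}

/-- Gaussian kernel mean. -/
noncomputable def edK (s : ℝ) (α β : Measure (EuclideanSpace ℝ (Fin D))) : ℝ :=
  ∫ p, Real.exp (-(s ^ 2 * ‖p.1 - p.2‖ ^ 2)) ∂(α.prod β)

lemma edK_integrable (s : ℝ) (α β : Measure (EuclideanSpace ℝ (Fin D)))
    [IsProbabilityMeasure α] [IsProbabilityMeasure β] :
    Integrable (fun p : EuclideanSpace ℝ (Fin D) × EuclideanSpace ℝ (Fin D) =>
      Real.exp (-(s ^ 2 * ‖p.1 - p.2‖ ^ 2))) (α.prod β) := by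
  refine Integrable.of_bound (C := 1) (by
    apply Continuous.aestronglyMeasurable; fun_prop) (.of_forall fun p => ?_)
  rw [Real.norm_eq_abs, abs_of_pos (Real.exp_pos _), Real.exp_le_one_iff]
  have : 0 ≤ s ^ 2 * ‖p.1 - p.2‖ ^ 2 := by positivity
  linarith

lemma ed_norm_integrable (α β : Measure (EuclideanSpace ℝ (Fin D)))
    [IsProbabilityMeasure α] [IsProbabilityMeasure β]
    (hα : Integrable (fun x => ‖x‖) α) (hβ : Integrable (fun x => ‖x‖) β) :
    Integrable (fun p : EuclideanSpace ℝ (Fin D) × EuclideanSpace ℝ (Fin D) =>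
      ‖p.1 - p.2‖) (α.prod β) := by
  refine ((hα.comp_fst β).add (hβ.comp_snd α)).mono' (by
    apply Continuous.aestronglyMeasurable; fun_prop) (.of_forall fun p => ?_)
  simpa using norm_sub_le p.1 p.2

lemma ed_repr (α β : Measure (EuclideanSpace ℝ (Fin D)))
    [IsProbabilityMeasure α] [IsProbabilityMeasure β]
    (hα : Integrable (fun x => ‖x‖) α) (hβ : Integrable (fun x => ‖x‖) β) :
    IntegrableOn (fun s : ℝ => (1 - edK s α β) / s ^ 2) (Ioi 0) ∧
    ∫ s in Ioi (0:ℝ), (1 - edK s α β) / s ^ 2 =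
      (∫ p, ‖p.1 - p.2‖ ∂(α.prod β)) * ∫ u in Ioi (0:ℝ), (1 - Real.exp (-u ^ 2)) / u ^ 2 := by
  let f : EuclideanSpace ℝ (Fin D) × EuclideanSpace ℝ (Fin D) → ℝ → ℝ := fun p s =>
    (1 - Real.exp (-(s ^ 2 * ‖p.1 - p.2‖ ^ 2))) / s ^ 2
  have hnn : ∀ p s, 0 ≤ f p s := by
    intro p s
    have : 0 ≤ s ^ 2 * ‖p.1 - p.2‖ ^ 2 := by positivity
    have : Real.exp (-(s ^ 2 * ‖p.1 - p.2‖ ^ 2)) ≤ 1 := Real.exp_le_one_iff.mpr (by linarith)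
    exact div_nonneg (by linarith) (by positivity)
  have hint : Integrable (Function.uncurry f) ((α.prod β).prod (volume.restrict (Ioi 0))) := by
    rw [integrable_prod_iff (by
      apply Measurable.aestronglyMeasurable
      unfold f Function.uncurry
      fun_prop)]
    refine ⟨.of_forall fun p => (ed_scaled _ (norm_nonneg (p.1 - p.2))).1, ?_⟩
    have : (fun p => ∫ s, ‖Function.uncurry f (p, s)‖ ∂(volume.restrict (Ioi 0))) =
        fun p => ‖p.1 - p.2‖ * ∫ u in Ioi (0:ℝ), (1 - Real.exp (-u ^ 2)) / u ^ 2 := by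
      ext p
      rw [← (ed_scaled _ (norm_nonneg (p.1 - p.2))).2]
      congr 1
      ext s
      exact abs_of_nonneg (hnn p s)
    rw [this]
    exact (ed_norm_integrable α β hα hβ).mul_const _
  have hk : (fun s => (1 - edK s α β) / s ^ 2) = fun s => ∫ p, f p s ∂(α.prod β) := by
    ext s
    simp only [f]
    rw [integral_div, integral_sub (integrable_const _) (edK_integrable s α β)]
    simp [edK]
  rw [hk]
  refine ⟨hint.integral_prod_right, ?_⟩
  rw [← integral_integral_swap hint, ← integral_mul_const]
  congr 1
  ext p
  exact (ed_scaled _ (norm_nonneg (p.1 - p.2))).2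

/-- Gaussian weight. -/
noncomputable def edW (v : EuclideanSpace ℝ (Fin D)) : ℝ := Real.exp (-(1 / 4) * ‖v‖ ^ 2)

lemma edW_pos (v : EuclideanSpace ℝ (Fin D)) : 0 < edW v := Real.exp_pos _

lemma edW_cont : Continuous (edW (D := D)) := by unfold edW; fun_prop

lemma edW_integral_pos : 0 < ∫ v : EuclideanSpace ℝ (Fin D), edW v := by
  unfold edW
  rw [GaussianFourier.integral_rexp_neg_mul_sq_norm (by norm_num)]
  positivity

lemma edW_integrable : Integrable (edW (D := D)) := by
  by_contra h
  exact edW_integral_pos.ne' (integral_undef h)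

lemma edW_fourier (s : ℝ) (x : EuclideanSpace ℝ (Fin D)) :
    ∫ v : EuclideanSpace ℝ (Fin D),
      (edW v : ℂ) * Complex.exp (((s * inner ℝ x v : ℝ) : ℂ) * Complex.I) =
    ((∫ v : EuclideanSpace ℝ (Fin D), edW v : ℝ) : ℂ) *
      (Real.exp (-(s ^ 2 * ‖x‖ ^ 2)) : ℂ) := by
  have hb : 0 < (1 / 4 : ℂ).re := by norm_num
  have h1 := GaussianFourier.integral_cexp_neg_mul_sq_norm_add hb (s * Complex.I) x
  have h2 := GaussianFourier.integral_cexp_neg_mul_sq_norm (V := EuclideanSpace ℝ (Fin D)) hb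
  rw [← integral_complex_ofReal]
  have e2 : (fun v : EuclideanSpace ℝ (Fin D) => (edW v : ℂ)) =
      fun v => Complex.exp (-(1 / 4) * ‖v‖ ^ 2) := by
    ext v; simp [edW]
  rw [e2, h2]
  convert h1 using 1
  · congr 1
    ext v
    rw [congrFun e2 v, ← Complex.exp_add]
    congr 1
    push_cast
    ring
  · congr 1
    push_cast
    congr 1
    rw [mul_pow, Complex.I_sq]
    ring

lemma edK_repr (s : ℝ) (α β : Measure (EuclideanSpace ℝ (Fin D)))
    [IsProbabilityMeasure α] [IsProbabilityMeasure β] :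
    ((∫ v : EuclideanSpace ℝ (Fin D), edW v : ℝ) : ℂ) * (edK s α β : ℂ) =
    ∫ v : EuclideanSpace ℝ (Fin D), (edW v : ℂ) *
      (charFun α (s • v) * (starRingEnd ℂ) (charFun β (s • v))) := by
  have h1 : ∀ v : EuclideanSpace ℝ (Fin D),
      charFun α (s • v) * (starRingEnd ℂ) (charFun β (s • v)) =
      ∫ p, Complex.exp (((s * inner ℝ (p.1 - p.2) v : ℝ) : ℂ) * Complex.I) ∂(α.prod β) := by
    intro v
    rw [← charFun_neg, charFun_apply, charFun_apply, ← integral_prod_mul]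
    congr 1
    ext p
    rw [← Complex.exp_add]
    congr 1
    rw [inner_neg_right, inner_smul_right, inner_smul_right, inner_sub_left]
    push_cast
    ring
  simp_rw [h1, ← integral_const_mul]
  rw [integral_integral_swap]
  · simp_rw [edW_fourier]
    rw [integral_const_mul, edK, integral_complex_ofReal]
  · have hi : Integrable (fun q : EuclideanSpace ℝ (Fin D) ×
        (EuclideanSpace ℝ (Fin D) × EuclideanSpace ℝ (Fin D)) => edW q.1)
        (volume.prod (α.prod β)) := edW_integrable.comp_fst _
    have := edW_cont (D := D)
    refine hi.mono' (by
      apply Continuous.aestronglyMeasurable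
      unfold Function.uncurry
      fun_prop) (.of_forall fun q => ?_)
    simp only [Function.uncurry, norm_mul, Complex.norm_exp_ofReal_mul_I, mul_one]
    rw [Complex.norm_real, Real.norm_eq_abs, abs_of_pos (edW_pos _)]

lemma edG_integrable (s : ℝ) (α β : Measure (EuclideanSpace ℝ (Fin D)))
    [IsProbabilityMeasure α] [IsProbabilityMeasure β] :
    Integrable (fun v : EuclideanSpace ℝ (Fin D) => (edW v : ℂ) *
      (charFun α (s • v) * (starRingEnd ℂ) (charFun β (s • v)))) := by
  have c1 := continuous_charFun (μ := α)
  have c2 := continuous_charFun (μ := β)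
  have := edW_cont (D := D)
  refine edW_integrable.mono' (by
    apply Continuous.aestronglyMeasurable
    have := Complex.continuous_conj
    fun_prop) (.of_forall fun v => ?_)
  rw [norm_mul, norm_mul, RCLike.norm_conj, Complex.norm_real, Real.norm_eq_abs,
    abs_of_pos (edW_pos _)]
  have a := norm_charFun_le_one (μ := α) (s • v)
  have b := norm_charFun_le_one (μ := β) (s • v)
  have := mul_le_one₀ a (norm_nonneg _) b
  nlinarith [edW_pos v]

lemma edG_repr (s : ℝ) (μ ν : Measure (EuclideanSpace ℝ (Fin D)))
    [IsProbabilityMeasure μ] [IsProbabilityMeasure ν] :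
    (∫ v : EuclideanSpace ℝ (Fin D), edW v) * (edK s μ μ + edK s ν ν - edK s μ ν - edK s ν μ) =
    ∫ v : EuclideanSpace ℝ (Fin D), edW v * ‖charFun μ (s • v) - charFun ν (s • v)‖ ^ 2 := by
  rw [← Complex.ofReal_inj, ← integral_complex_ofReal]
  push_cast
  simp only [mul_sub, mul_add]
  rw [edK_repr, edK_repr, edK_repr, edK_repr,
    ← integral_add (edG_integrable s μ μ) (edG_integrable s ν ν)]
  have j1 := (edG_integrable s μ μ).add (edG_integrable s ν ν)
  have j2 := j1.sub (edG_integrable s μ ν)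
  refine ((congrArg (fun z => z - _) (integral_sub j1 (edG_integrable s μ ν)).symm).trans
    (integral_sub j2 (edG_integrable s ν μ)).symm).trans ?_
  congr 1
  ext v
  simp only [Pi.add_apply, Pi.sub_apply]
  rw [← Complex.mul_conj', map_sub]
  ring

lemma edK_comm (s : ℝ) (μ ν : Measure (EuclideanSpace ℝ (Fin D)))
    [IsProbabilityMeasure μ] [IsProbabilityMeasure ν] : edK s ν μ = edK s μ ν := by
  unfold edK
  rw [← integral_prod_swap]
  simp [norm_sub_rev]

lemma edG_integrable' (s : ℝ) (μ ν : Measure (EuclideanSpace ℝ (Fin D)))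
    [IsProbabilityMeasure μ] [IsProbabilityMeasure ν] :
    Integrable (fun v : EuclideanSpace ℝ (Fin D) =>
      edW v * ‖charFun μ (s • v) - charFun ν (s • v)‖ ^ 2) := by
  have c1 := continuous_charFun (μ := μ)
  have c2 := continuous_charFun (μ := ν)
  have := edW_cont (D := D)
  refine (edW_integrable.mul_const 4).mono' (by
    apply Continuous.aestronglyMeasurable
    fun_prop) (.of_forall fun v => ?_)
  rw [Real.norm_eq_abs, abs_of_nonneg (mul_nonneg (edW_pos v).le (by positivity))]
  have a := norm_charFun_le_one (μ := μ) (s • v)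
  have b := norm_charFun_le_one (μ := ν) (s • v)
  have c := norm_sub_le (charFun μ (s • v)) (charFun ν (s • v))
  have d := norm_nonneg (charFun μ (s • v) - charFun ν (s • v))
  exact mul_le_mul_of_nonneg_left (by nlinarith) (edW_pos v).le

end EDAux

/-- **Energy distance is nonnegative and characterizes equality of distributions**: for
probability measures `μ`, `ν` on `ℝ^D` with finite first moments, `ED(μ,ν) ≥ 0`, and
`ED(μ,ν) = 0` if and only if `μ = ν`. -/
theorem energyDist_nonneg_and_eq_zero_iff {D : ℕ}
    (μ ν : Measure (EuclideanSpace ℝ (Fin D)))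
    [IsProbabilityMeasure μ] [IsProbabilityMeasure ν]
    (hμ : Integrable (fun x => ‖x‖) μ) (hν : Integrable (fun x => ‖x‖) ν) :
    0 ≤ energyDist μ ν ∧ (energyDist μ ν = 0 ↔ μ = ν) := by
  obtain ⟨i1, r1⟩ := ed_repr μ ν hμ hν
  obtain ⟨i2, r2⟩ := ed_repr μ μ hμ hμ
  obtain ⟨i3, r3⟩ := ed_repr ν ν hν hν
  have hC := ed_const_pos
  set C := ∫ u in Ioi (0:ℝ), (1 - Real.exp (-u ^ 2)) / u ^ 2
  have hW := edW_integral_pos (D := D)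
  have hG : ∀ s, 0 ≤ edK s μ μ + edK s ν ν - edK s μ ν - edK s ν μ := by
    intro s
    refine nonneg_of_mul_nonneg_right ?_ hW
    rw [edG_repr]
    exact integral_nonneg fun v => mul_nonneg (edW_pos v).le (by positivity)
  have heq : (fun s : ℝ => 2 * ((1 - edK s μ ν) / s ^ 2) - (1 - edK s μ μ) / s ^ 2
      - (1 - edK s ν ν) / s ^ 2) =
      fun s => (edK s μ μ + edK s ν ν - edK s μ ν - edK s ν μ) / s ^ 2 := by
    ext s
    rw [edK_comm s μ ν]
    ring
  have hint := ((i1.const_mul 2).sub i2).sub i3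
  have key : energyDist μ ν * C =
      ∫ s in Ioi (0:ℝ), (edK s μ μ + edK s ν ν - edK s μ ν - edK s ν μ) / s ^ 2 := by
    rw [← heq]
    refine Eq.trans ?_ (integral_sub ((i1.const_mul 2).sub i2) i3).symm
    refine Eq.trans ?_ (congrArg (fun z => z - _) (integral_sub (i1.const_mul 2) i2).symm)
    rw [integral_const_mul, r1, r2, r3, energyDist]
    ring
  have hint' : IntegrableOn (fun s : ℝ =>
      (edK s μ μ + edK s ν ν - edK s μ ν - edK s ν μ) / s ^ 2) (Ioi 0) := by
    rw [← heq]; exact hint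
  have hnn : ∀ s : ℝ, 0 ≤ (edK s μ μ + edK s ν ν - edK s μ ν - edK s ν μ) / s ^ 2 :=
    fun s => div_nonneg (hG s) (by positivity)
  refine ⟨?_, ?_, ?_⟩
  · refine nonneg_of_mul_nonneg_left ?_ hC
    rw [key]
    exact integral_nonneg hnn
  · intro h0
    rw [h0, zero_mul] at key
    have hz := (integral_eq_zero_iff_of_nonneg hnn hint').1 key.symm
    have : NeZero (volume.restrict (Ioi (0:ℝ))) := ⟨by simp⟩
    obtain ⟨s, hs, hs0⟩ := (hz.and (ae_restrict_mem measurableSet_Ioi)).exists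
    have hs0 : 0 < s := hs0
    have hGs : edK s μ μ + edK s ν ν - edK s μ ν - edK s ν μ = 0 := by
      have hs' : (edK s μ μ + edK s ν ν - edK s μ ν - edK s ν μ) / s ^ 2 = 0 := hs
      simpa [hs0.ne'] using hs'
    have hr := edG_repr s μ ν
    rw [hGs, mul_zero] at hr
    have hz2 := (integral_eq_zero_iff_of_nonneg
      (fun v => mul_nonneg (edW_pos v).le (by positivity)) (edG_integrable' s μ ν)).1 hr.symm
    have c1 := continuous_charFun (μ := μ)
    have c2 := continuous_charFun (μ := ν)
    have c3 := edW_cont (D := D)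
    have c4 : Continuous (fun v : EuclideanSpace ℝ (Fin D) =>
        edW v * ‖charFun μ (s • v) - charFun ν (s • v)‖ ^ 2) := by fun_prop
    have hall := (Continuous.ae_eq_iff_eq volume c4 (by exact continuous_zero)).1 hz2
    apply Measure.ext_of_charFun
    ext t
    have ht := congrFun hall (s⁻¹ • t)
    simp only [smul_smul, mul_inv_cancel₀ hs0.ne', one_smul, Pi.zero_apply, mul_eq_zero,
      (edW_pos _).ne', false_or] at ht
    exact sub_eq_zero.1 (norm_eq_zero.1 (pow_eq_zero_iff two_ne_zero |>.1 ht))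
  · rintro rfl
    unfold energyDist
    ring
end

section
/- (Energy distance generalizes the CRPS: one-dimensional Cramér identity) Let μ and ν be probability measures on ℝ with finite first moments, with CDFs F_μ and F_ν respectively. Then ED(μ,ν) = 2·∫_ℝ (F_μ(z) − F_ν(z))² dz, where ED(μ,ν) = 2·E|X − Y| − E|X − X'| − E|Y − Y'| with X, X' ~ μ, Y, Y' ~ ν all independent. -/
open MeasureTheory Set

/-- The energy distance between two probability measures `μ`, `ν` on `ℝ`:
`ED(μ,ν) = 2·E|X − Y| − E|X − X'| − E|Y − Y'|`, where `X, X' ∼ μ`, `Y, Y' ∼ ν` are all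
independent. -/
noncomputable def energyDist1 (μ ν : Measure ℝ) : ℝ :=
  2 * ∫ p, |p.1 - p.2| ∂(μ.prod ν) - ∫ p, |p.1 - p.2| ∂(μ.prod μ)
    - ∫ p, |p.1 - p.2| ∂(ν.prod ν)

/-- The key Fubini step, for a pair of probability measures. -/
lemma ed_key (α β : Measure ℝ) [IsProbabilityMeasure α] [IsProbabilityMeasure β]
    (hα : Integrable (fun x => |x|) α) (hβ : Integrable (fun x => |x|) β) :
    Integrable (fun z : ℝ => (α (Iic z)).toReal * (1 - (β (Iic z)).toReal)
        + (1 - (α (Iic z)).toReal) * (β (Iic z)).toReal) ∧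
    ∫ p, |p.1 - p.2| ∂(α.prod β) = ∫ z : ℝ, ((α (Iic z)).toReal * (1 - (β (Iic z)).toReal)
        + (1 - (α (Iic z)).toReal) * (β (Iic z)).toReal) := by
  let S : Set ((ℝ × ℝ) × ℝ) := {q | min q.1.1 q.1.2 ≤ q.2} ∩ {q | q.2 < max q.1.1 q.1.2}
  have hS : MeasurableSet S :=
    (measurableSet_le (by fun_prop) (by fun_prop)).inter
      (measurableSet_lt (by fun_prop) (by fun_prop))
  let h : (ℝ × ℝ) × ℝ → ℝ := S.indicator (fun _ => 1)
  have hslice : ∀ p : ℝ × ℝ, (fun z => h (p, z))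
      = (Ico (min p.1 p.2) (max p.1 p.2)).indicator (fun _ => 1) := by
    intro p; rfl
  have hint : ∀ p : ℝ × ℝ, ∫ z, h (p, z) = |p.1 - p.2| := by
    intro p
    rw [hslice, integral_indicator measurableSet_Ico]
    simp [max_sub_min_eq_abs, abs_sub_comm]
  have hnn : ∀ q, 0 ≤ h q := fun q => indicator_nonneg (fun _ _ => zero_le_one) q
  have hαβ : Integrable (fun p : ℝ × ℝ => |p.1 - p.2|) (α.prod β) := by
    have h1 : Integrable (fun x : ℝ => x) α := 
      (integrable_norm_iff (by fun_prop)).1 (by simpa [Real.norm_eq_abs] using hα)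
    have h2 : Integrable (fun x : ℝ => x) β := 
      (integrable_norm_iff (by fun_prop)).1 (by simpa [Real.norm_eq_abs] using hβ)
    exact ((h1.comp_fst β).sub (h2.comp_snd α)).abs
  have hI : Integrable h ((α.prod β).prod volume) := by
    rw [integrable_prod_iff (measurable_const.indicator hS).aestronglyMeasurable]
    refine ⟨Filter.Eventually.of_forall fun p => ?_, ?_⟩
    · rw [hslice, integrable_indicator_iff measurableSet_Ico]
      exact integrableOn_const (by simp)
    · have hn : ∀ q, ‖h q‖ = h q := fun q => Real.norm_of_nonneg (hnn q)
      refine hαβ.congr (Filter.Eventually.of_forall fun p => ?_)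
      change |p.1 - p.2| = ∫ z, ‖h (p, z)‖
      rw [← hint p]
      exact integral_congr_ae (Filter.Eventually.of_forall fun z => (hn (p, z)).symm)
  have hz : ∀ z : ℝ, ∫ p, h (p, z) ∂(α.prod β) = (α (Iic z)).toReal * (1 - (β (Iic z)).toReal)
        + (1 - (α (Iic z)).toReal) * (β (Iic z)).toReal := by
    intro z
    let a : ℝ → ℝ := (Iic z).indicator (fun _ => 1)
    have ha : ∀ (m : Measure ℝ) [IsProbabilityMeasure m], Integrable a m := fun m _ =>
      (integrable_const _).indicator measurableSet_Iic
    have hai : ∀ (m : Measure ℝ) [IsProbabilityMeasure m], ∫ x, a x ∂m = (m (Iic z)).toReal := by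
      intro m _
      simp only [a]
      rw [integral_indicator measurableSet_Iic]
      simp [Measure.real]
    have hb : ∀ (m : Measure ℝ) [IsProbabilityMeasure m], Integrable (fun x => 1 - a x) m :=
      fun m _ => (integrable_const _).sub (ha m)
    have hbi : ∀ (m : Measure ℝ) [IsProbabilityMeasure m],
        ∫ x, (1 - a x) ∂m = 1 - (m (Iic z)).toReal := by
      intro m _
      rw [integral_sub (integrable_const _) (ha m), hai]
      simp
    have e : ∀ p : ℝ × ℝ, h (p, z) = a p.1 * (1 - a p.2) + (1 - a p.1) * a p.2 := by
      intro p
      simp only [h, a, S, indicator_apply, mem_inter_iff, mem_ofPred_eq, mem_Iic, min_le_iff,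
        lt_max_iff]
      by_cases h1 : p.1 ≤ z <;> by_cases h2 : p.2 ≤ z <;>
        simp [h1, h2, not_lt.2, not_le.1]
    simp only [e]
    rw [integral_add ((ha α).mul_prod (hb β)) ((hb α).mul_prod (ha β)),
      integral_prod_mul a (fun y => 1 - a y), integral_prod_mul (fun y => 1 - a y) a,
      hai, hai, hbi, hbi]
  constructor
  · have := hI.integral_prod_right
    simpa only [hz] using this
  · simp only [← hz, ← hint]
    exact integral_integral_swap (f := fun p z => h (p, z)) hI

/-- **One-dimensional Cramér identity**: for probability measures `μ`, `ν` on `ℝ` with finite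
first moments and CDFs `F_μ`, `F_ν`, the energy distance satisfies
`ED(μ,ν) = 2·∫_ℝ (F_μ(z) − F_ν(z))² dz`. -/
theorem energyDist_eq_two_mul_integral_sq_cdf_sub (μ ν : Measure ℝ)
    [IsProbabilityMeasure μ] [IsProbabilityMeasure ν]
    (hμ : Integrable (fun x => |x|) μ) (hν : Integrable (fun x => |x|) ν) :
    energyDist1 μ ν
      = 2 * ∫ z : ℝ, ((μ (Set.Iic z)).toReal - (ν (Set.Iic z)).toReal) ^ 2 := by
  obtain ⟨i1, e1⟩ := ed_key μ ν hμ hν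
  obtain ⟨i2, e2⟩ := ed_key μ μ hμ hμ
  obtain ⟨i3, e3⟩ := ed_key ν ν hν hν
  rw [energyDist1, e1, e2, e3, ← integral_const_mul, ← integral_const_mul,
    ← integral_sub (i1.const_mul 2) i2]
  refine (integral_sub ((i1.const_mul 2).sub i2) i3).symm.trans ?_
  refine integral_congr_ae (Filter.Eventually.of_forall fun z => ?_)
  simp only [Pi.sub_apply]
  ring
end
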